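/- arXiv:2605.25349 — 2 statements merged into one kernel-verified Lean document; each statement's English description precedes it below -/
import Mathlib

section
/- Let $b, a \ge 1$ and consider the symmetric block matrix $C = \begin{pmatrix} d_1 I_b + c_{11}(J_b - I_b) & c_{12}\mathbf{1}_b\mathbf{1}_a^\top \\ c_{12}\mathbf{1}_a\mathbf{1}_b^\top & d_2 I_a + c_{22}(J_a - I_a)\end{pmatrix}$ with real entries $d_1,d_2,c_{11},c_{12},c_{22}$. Then $C$ is positive semidefinite if and only if $d_1 - c_{11} \ge 0$, $d_2 - c_{22} \ge 0$, $d_1 + (b-1)c_{11} \ge 0$, $d_2 + (a-1)c_{22} \ge 0$, and $(d_1 + (b-1)c_{11})(d_2 + (a-1)c_{22}) \ge ab\, c_{12}^2$ (with the conditions $d_1 - c_{11} \ge 0$ resp. $d_2 - c_{22} \ge 0$ dropped when $b = 1$ resp. $a = 1$). -/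
open Matrix

/-- The two-block symmetric matrix
`[[d₁ I_b + c₁₁ (J_b - I_b), c₁₂ 𝟙𝟙ᵀ], [c₁₂ 𝟙𝟙ᵀ, d₂ I_a + c₂₂ (J_a - I_a)]]`. -/
noncomputable def blockPattern (b a : ℕ) (d₁ d₂ c₁₁ c₁₂ c₂₂ : ℝ) :
    Matrix (Fin b ⊕ Fin a) (Fin b ⊕ Fin a) ℝ :=
  Matrix.of fun i j =>
    match i, j with
    | Sum.inl i, Sum.inl j => if i = j then d₁ else c₁₁
    | Sum.inl _, Sum.inr _ => c₁₂
    | Sum.inr _, Sum.inl _ => c₁₂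
    | Sum.inr i, Sum.inr j => if i = j then d₂ else c₂₂

lemma blockPattern_quad (b a : ℕ) (d₁ d₂ c₁₁ c₁₂ c₂₂ : ℝ) (v : Fin b ⊕ Fin a → ℝ) :
    v ⬝ᵥ (blockPattern b a d₁ d₂ c₁₁ c₁₂ c₂₂ *ᵥ v) =
      (d₁ - c₁₁) * ∑ i, v (Sum.inl i) ^ 2 + c₁₁ * (∑ i, v (Sum.inl i)) ^ 2
      + 2 * c₁₂ * (∑ i, v (Sum.inl i)) * (∑ j, v (Sum.inr j))
      + (d₂ - c₂₂) * ∑ j, v (Sum.inr j) ^ 2 + c₂₂ * (∑ j, v (Sum.inr j)) ^ 2 := by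
  have key : ∀ (n : ℕ) (d c : ℝ) (x : Fin n → ℝ) (i : Fin n),
      ∑ j, (if i = j then d else c) * x j = (d - c) * x i + c * ∑ j, x j := by
    intro n d c x i
    have : ∀ j, (if i = j then d else c) * x j = (if i = j then (d - c) * x j else 0) + c * x j := by
      intro j
      split_ifs <;> ring
    simp_rw [this, Finset.sum_add_distrib, Finset.mul_sum]
    simp
  have h1 : ∀ i, (blockPattern b a d₁ d₂ c₁₁ c₁₂ c₂₂ *ᵥ v) (Sum.inl i) =
      (d₁ - c₁₁) * v (Sum.inl i) + c₁₁ * (∑ j, v (Sum.inl j)) + c₁₂ * ∑ j, v (Sum.inr j) := by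
    intro i
    rw [← key b d₁ c₁₁ (fun j => v (Sum.inl j)) i, Finset.mul_sum]
    simp [Matrix.mulVec, dotProduct, blockPattern]
  have h2 : ∀ i, (blockPattern b a d₁ d₂ c₁₁ c₁₂ c₂₂ *ᵥ v) (Sum.inr i) =
      c₁₂ * (∑ j, v (Sum.inl j)) +
      ((d₂ - c₂₂) * v (Sum.inr i) + c₂₂ * (∑ j, v (Sum.inr j))) := by
    intro i
    rw [← key a d₂ c₂₂ (fun j => v (Sum.inr j)) i, Finset.mul_sum]
    simp [Matrix.mulVec, dotProduct, blockPattern]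
  have h3 : ∀ (n : ℕ) (x : Fin n → ℝ) (p q : ℝ), ∑ i, x i * (p * x i + q) =
      p * ∑ i, x i ^ 2 + q * ∑ i, x i := by
    intro n x p q
    rw [Finset.mul_sum, Finset.mul_sum, ← Finset.sum_add_distrib]
    exact Finset.sum_congr rfl fun i _ => by ring
  have e1 := h3 b (fun i => v (Sum.inl i)) (d₁ - c₁₁)
    (c₁₁ * (∑ j, v (Sum.inl j)) + c₁₂ * ∑ j, v (Sum.inr j))
  have e2 := h3 a (fun i => v (Sum.inr i)) (d₂ - c₂₂)
    (c₂₂ * (∑ j, v (Sum.inr j)) + c₁₂ * ∑ j, v (Sum.inl j))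
  rw [dotProduct, Fintype.sum_sum_type]
  have h1' := fun i => (h1 i).trans (add_assoc _ _ _)
  have h2' := fun i => (h2 i).trans ((add_comm _ _).trans (add_assoc _ _ _))
  simp_rw [h1', h2']
  rw [e1, e2]
  ring

lemma blockPattern_psd_iff_quad (b a : ℕ) (d₁ d₂ c₁₁ c₁₂ c₂₂ : ℝ) :
    (blockPattern b a d₁ d₂ c₁₁ c₁₂ c₂₂).PosSemidef ↔
      ∀ (x : Fin b → ℝ) (y : Fin a → ℝ), 0 ≤
      (d₁ - c₁₁) * ∑ i, x i ^ 2 + c₁₁ * (∑ i, x i) ^ 2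
      + 2 * c₁₂ * (∑ i, x i) * (∑ j, y j)
      + (d₂ - c₂₂) * ∑ j, y j ^ 2 + c₂₂ * (∑ j, y j) ^ 2 := by
  rw [posSemidef_iff_dotProduct_mulVec]
  constructor
  · rintro ⟨-, h⟩ x y
    have := h (Sum.elim x y)
    rw [star_trivial, blockPattern_quad] at this
    simpa using this
  · intro h
    refine ⟨?_, fun v => ?_⟩
    · ext i j
      rcases i with i | i <;> rcases j with j | j <;> simp [blockPattern, eq_comm]
    · rw [star_trivial, blockPattern_quad]
      exact h _ _

lemma blockPattern_diff {n : ℕ} (hn : 1 < n) : ∃ x : Fin n → ℝ,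
    ∑ i, x i = 0 ∧ 0 < ∑ i, x i ^ 2 := by
  refine ⟨Pi.single ⟨0, by omega⟩ 1 - Pi.single ⟨1, hn⟩ 1, by simp, ?_⟩
  apply Finset.sum_pos' (fun i _ => sq_nonneg _)
  exact ⟨⟨0, by omega⟩, Finset.mem_univ _, by simp [Pi.single_apply]⟩

lemma blockPattern_cs {n : ℕ} (hn : 1 ≤ n) (e : ℝ) (he : 1 < n → 0 ≤ e) (x : Fin n → ℝ) :
    0 ≤ e * ((n : ℝ) * ∑ i, x i ^ 2 - (∑ i, x i) ^ 2) := by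
  rcases hn.eq_or_lt with h | h
  · subst h
    simp
  · apply mul_nonneg (he h)
    have := sq_sum_le_card_mul_sum_sq (s := Finset.univ) (f := x)
    simp at this
    linarith

lemma blockPattern_two {A B C : ℝ} (hA : 0 ≤ A) (hC : 0 ≤ C) (h : B ^ 2 ≤ A * C) (s t : ℝ) :
    0 ≤ A * s ^ 2 + 2 * B * s * t + C * t ^ 2 := by
  rcases hA.eq_or_lt with h0 | h0
  · subst h0
    have : B = 0 := by nlinarith
    subst this
    nlinarith [mul_nonneg hC (sq_nonneg t)]
  · have : 0 ≤ A * (A * s ^ 2 + 2 * B * s * t + C * t ^ 2) := by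
      nlinarith [sq_nonneg (A * s + B * t), mul_nonneg (sub_nonneg.2 h) (sq_nonneg t)]
    exact nonneg_of_mul_nonneg_right this h0

/-- PSD criterion for the two-block pattern matrix. -/
theorem blockPattern_posSemidef_iff (b a : ℕ) (hb : 1 ≤ b) (ha : 1 ≤ a)
    (d₁ d₂ c₁₁ c₁₂ c₂₂ : ℝ) :
    (blockPattern b a d₁ d₂ c₁₁ c₁₂ c₂₂).PosSemidef ↔
      (1 < b → 0 ≤ d₁ - c₁₁) ∧ (1 < a → 0 ≤ d₂ - c₂₂) ∧
      0 ≤ d₁ + ((b : ℝ) - 1) * c₁₁ ∧ 0 ≤ d₂ + ((a : ℝ) - 1) * c₂₂ ∧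
      (a : ℝ) * b * c₁₂ ^ 2 ≤ (d₁ + ((b : ℝ) - 1) * c₁₁) * (d₂ + ((a : ℝ) - 1) * c₂₂) := by
  rw [blockPattern_psd_iff_quad]
  have hb' : (0 : ℝ) < b := by exact_mod_cast hb
  have ha' : (0 : ℝ) < a := by exact_mod_cast ha
  constructor
  · intro h
    have hc : ∀ s t : ℝ, 0 ≤ b * (d₁ + ((b : ℝ) - 1) * c₁₁) * s ^ 2
        + 2 * (a * b * c₁₂) * s * t + a * (d₂ + ((a : ℝ) - 1) * c₂₂) * t ^ 2 := by
      intro s t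
      have := h (fun _ => s) (fun _ => t)
      simp at this
      nlinarith
    refine ⟨fun h1 => ?_, fun h1 => ?_, ?_, ?_, ?_⟩
    · obtain ⟨x, hx, hx'⟩ := blockPattern_diff h1
      have := h x 0
      simp [hx] at this
      exact sub_nonneg.1 (nonneg_of_mul_nonneg_left this hx') |> sub_nonneg.2
    · obtain ⟨x, hx, hx'⟩ := blockPattern_diff h1
      have := h 0 x
      simp [hx] at this
      exact sub_nonneg.1 (nonneg_of_mul_nonneg_left this hx') |> sub_nonneg.2
    · have := hc 1 0
      exact nonneg_of_mul_nonneg_right (by linarith) hb'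
    · have := hc 0 1
      exact nonneg_of_mul_nonneg_right (by linarith) ha'
    · have := discrim_le_zero (a := b * (d₁ + ((b : ℝ) - 1) * c₁₁)) (b := 2 * (a * b * c₁₂))
        (c := a * (d₂ + ((a : ℝ) - 1) * c₂₂)) (fun s => by linarith [hc s 1])
      rw [discrim] at this
      refine le_of_mul_le_mul_left (a := (a : ℝ) * b) ?_ (by positivity)
      linarith
  · rintro ⟨h1, h2, hp, hq, hd⟩ x y
    have k1 := mul_nonneg ha'.le (blockPattern_cs hb _ h1 x)
    have k2 := mul_nonneg hb'.le (blockPattern_cs ha _ h2 y)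
    have k3 := blockPattern_two (mul_nonneg ha'.le hp) (mul_nonneg hb'.le hq)
      (B := a * b * c₁₂) (by
        have := mul_le_mul_of_nonneg_left hd (mul_pos ha' hb').le
        linarith) (∑ i, x i) (∑ i, y i)
    refine nonneg_of_mul_nonneg_right (a := (a : ℝ) * b) ?_ (by positivity)
    linarith
end

section
/- Let $N \ge 1$ and let $p_t(x) = \frac{c_t x^{r_t}}{c_t x^{r_t} + a_t}$ for positive constants $c_t, a_t$ and $r_t \in (0,1]$, $t = 1,\dots,2N+1$. Then the function $f(v_1,\dots,v_{2N+1}) = \Pr\big(\sum_t X_t \ge N+1\big)$, where $X_t$ are independent Bernoulli with success probabilities $p_t(v_t)$, is log-concave on the open positive orthant $(0,\infty)^{2N+1}$. -/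
open Finset

/-- Reduced-form Tullock battle-winning probability in battle `t` as a function of
team A's prize `x`, holding the opponent's term `a_t` fixed:
`p_t(x) = c_t x^{r_t} / (c_t x^{r_t} + a_t)`. -/
noncomputable def battleP (c a r : ℝ) (x : ℝ) : ℝ :=
  c * x ^ r / (c * x ^ r + a)

/-- Team A's majority-winning probability as a function of its prize vector `v`. -/
noncomputable def majorityWinProb (N : ℕ) (c a r : Fin (2 * N + 1) → ℝ)
    (v : Fin (2 * N + 1) → ℝ) : ℝ :=
  ∑ w ∈ (Finset.univ : Finset (Fin (2 * N + 1))).powerset.filter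
      (fun w => N + 1 ≤ w.card),
    (∏ t ∈ w, battleP (c t) (a t) (r t) (v t)) *
      ∏ q ∈ Finset.univ \ w, (1 - battleP (c q) (a q) (r q) (v q))


section helpers
set_option linter.unusedSectionVars false
variable {ι : Type*} [DecidableEq ι]

/-- elementary symmetric polynomial of the variables in `s` -/
def es (s : Finset ι) (k : ℕ) (u : ι → ℝ) : ℝ := ∑ W ∈ s.powersetCard k, ∏ i ∈ W, u i

lemma es_zero (s : Finset ι) (u : ι → ℝ) : es s 0 u = 1 := by simp [es]

lemma es_empty_succ (k : ℕ) (u : ι → ℝ) : es (∅ : Finset ι) (k + 1) u = 0 := by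
  unfold es; rw [powersetCard_eq_empty.2 (by simp)]; simp

lemma es_insert {s : Finset ι} {a : ι} (ha : a ∉ s) (k : ℕ) (u : ι → ℝ) :
    es (insert a s) (k + 1) u = es s (k + 1) u + u a * es s k u := by
  unfold es
  rw [powersetCard_succ_insert ha, sum_union, sum_image, mul_sum]
  · congr 1
    apply sum_congr rfl
    intro W hW
    rw [prod_insert]
    exact fun h => ha ((mem_powersetCard.1 hW).1 h)
  · intro W hW V hV h
    have h1 : a ∉ W := fun h => ha ((mem_powersetCard.1 hW).1 h)
    have h2 : a ∉ V := fun h => ha ((mem_powersetCard.1 hV).1 h)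
    rw [← erase_insert h1, ← erase_insert h2]
    exact congrArg (fun z => erase z a) h
  · rw [disjoint_left]
    intro W hW hV
    obtain ⟨V, _, rfl⟩ := mem_image.1 hV
    exact ha ((mem_powersetCard.1 hW).1 (mem_insert_self a V))

lemma es_erase {s : Finset ι} {a : ι} (ha : a ∈ s) (k : ℕ) (u : ι → ℝ) :
    es s (k + 1) u = es (s.erase a) (k + 1) u + u a * es (s.erase a) k u := by
  conv_lhs => rw [← insert_erase ha]
  exact es_insert (notMem_erase a s) k u

lemma es_nonneg (s : Finset ι) (k : ℕ) {u : ι → ℝ} (hu : ∀ i, 0 < u i) : 0 ≤ es s k u :=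
  sum_nonneg fun _ _ => prod_nonneg fun i _ => (hu i).le

lemma es_pos {s : Finset ι} {k : ℕ} (h : k ≤ s.card) {u : ι → ℝ} (hu : ∀ i, 0 < u i) :
    0 < es s k u :=
  sum_pos (fun _ _ => prod_pos fun i _ => hu i) (powersetCard_nonempty.2 h)

lemma es_eq_zero {s : Finset ι} {k : ℕ} (h : s.card < k) (u : ι → ℝ) : es s k u = 0 := by
  unfold es; rw [powersetCard_eq_empty.2 h]; simp

lemma es_two (s : Finset ι) (k : ℕ) (u : ι → ℝ) :
    es s k (fun i => 2 * u i) = 2 ^ k * es s k u := by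
  unfold es
  rw [mul_sum]
  apply sum_congr rfl
  intro W hW
  rw [prod_mul_distrib, prod_const, (mem_powersetCard.1 hW).2]

lemma sum_insert_erase {s : Finset ι} {a : ι} (ha : a ∉ s) (k : ℕ) (u d : ι → ℝ) :
    ∑ i ∈ insert a s, d i * es ((insert a s).erase i) (k + 1) u =
      d a * es s (k + 1) u + ∑ i ∈ s, d i * es (s.erase i) (k + 1) u
        + u a * ∑ i ∈ s, d i * es (s.erase i) k u := by
  rw [sum_insert ha, erase_insert ha, mul_sum, add_assoc, ← sum_add_distrib]
  congr 1
  apply sum_congr rfl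
  intro i hi
  have hne : a ≠ i := fun h => ha (h ▸ hi)
  rw [erase_insert_of_ne hne, es_insert (fun h => ha (mem_of_mem_erase h))]
  ring

lemma es_euler (s : Finset ι) (u : ι → ℝ) : ∀ k : ℕ,
    ((k : ℝ) + 1) * es s (k + 1) u = ∑ i ∈ s, u i * es (s.erase i) k u := by
  induction s using Finset.induction_on with
  | empty => intro k; simp [es_empty_succ]
  | insert a s ha ih =>
    intro k
    rw [es_insert ha]
    cases k with
    | zero =>
      have := ih 0
      simp only [es_zero] at this ⊢
      rw [sum_insert ha, ← this]; push_cast; ring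
    | succ k =>
      rw [sum_insert_erase ha, ← ih k, ← ih (k + 1)]; push_cast; ring

lemma hasDerivAt_es (s : Finset ι) {u : ℝ → ι → ℝ} {d : ι → ℝ} {x : ℝ}
    (hu : ∀ i, HasDerivAt (fun t => u t i) (d i) x) : ∀ k : ℕ,
    HasDerivAt (fun t => es s (k + 1) (u t)) (∑ i ∈ s, d i * es (s.erase i) k (u x)) x := by
  induction s using Finset.induction_on with
  | empty => intro k; simpa [es_empty_succ] using hasDerivAt_const x (0 : ℝ)
  | insert a s ha ih =>
    intro k
    simp only [es_insert ha]
    cases k with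
    | zero =>
      have h := (ih 0).add (hu a)
      simp only [es_zero, mul_one] at h ⊢
      rw [sum_insert ha, add_comm (d a)]
      exact h
    | succ k =>
      have h := (ih (k + 1)).add ((hu a).mul (ih k))
      rw [sum_insert_erase ha]
      refine h.congr_deriv ?_
      ring

lemma es_newton (s : Finset ι) {u : ι → ℝ} (hu : ∀ i, 0 < u i) : ∀ k j : ℕ, k ≤ j →
    es s (j + 1) u * es s k u ≤ es s j u * es s (k + 1) u := by
  induction s using Finset.induction_on with
  | empty =>
    intro k j _
    rw [es_empty_succ, zero_mul]
    exact mul_nonneg (es_nonneg _ _ hu) (es_nonneg _ _ hu)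
  | insert a s ha ih =>
    intro k j hkj
    have ha0 := (hu a).le
    rcases Nat.eq_or_lt_of_le hkj with rfl | hlt
    · rw [mul_comm]
    obtain ⟨j, rfl⟩ : ∃ j', j = j' + 1 := ⟨j - 1, by omega⟩
    cases k with
    | zero =>
      simp only [es_insert ha, es_zero]
      have h1 := ih 0 (j + 1) (by omega)
      have h2 := ih 0 j (by omega)
      simp only [es_zero, zero_add] at h1 h2 ⊢
      have e1 := es_nonneg s (j + 1) hu
      have e2 := es_nonneg s j hu
      have e3 := es_nonneg s 1 hu
      nlinarith [mul_nonneg ha0 (mul_nonneg e2 e3), mul_nonneg ha0 (mul_nonneg ha0 e2)]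
    | succ k =>
      simp only [es_insert ha]
      have h1 := ih (k + 1) (j + 1) (by omega)
      have h2 := ih k j (by omega)
      have h3 := ih k (j + 1) (by omega)
      have h4 := ih (k + 1) j (by omega)
      have h5 := mul_le_mul_of_nonneg_left h2 (mul_nonneg ha0 ha0)
      have h6 := mul_le_mul_of_nonneg_left (h3.trans h4) ha0
      nlinarith

lemma par_superadd {a b c d : ℝ} (ha : 0 < a) (hb : 0 < b) (hc : 0 < c) (hd : 0 < d) :
    a * c / (a + c) + b * d / (b + d) ≤ (a + b) * (c + d) / ((a + b) + (c + d)) := by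
  rw [div_add_div _ _ (by positivity) (by positivity), div_le_div_iff₀ (by positivity) (by positivity)]
  nlinarith [sq_nonneg (a * d - b * c)]

lemma par_mono {a b c : ℝ} (ha : 0 < a) (hb : 0 < b) (hbc : b ≤ c) :
    a * b / (a + b) ≤ a * c / (a + c) := by
  have hc := hb.trans_le hbc
  rw [div_le_div_iff₀ (by positivity) (by positivity)]
  nlinarith [mul_le_mul_of_nonneg_left hbc (mul_pos ha ha).le]

lemma es_ratio (k : ℕ) : ∀ s : Finset ι, k ≤ s.card → ∀ x y : ι → ℝ, (∀ i, 0 < x i) →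
    (∀ i, 0 < y i) →
    es s (k + 1) x / es s k x + es s (k + 1) y / es s k y ≤
      es s (k + 1) (fun i => x i + y i) / es s k (fun i => x i + y i) := by
  induction k with
  | zero =>
    intro s _ x y _ _
    have h := fun u => es_euler s u 0
    simp only [es_zero, Nat.cast_zero, zero_add, one_mul, mul_one] at h
    simp only [es_zero, h, zero_add, div_one, sum_add_distrib]
    exact le_rfl
  | succ k ih =>
    intro s hs x y hx hy
    have hxy : ∀ i, 0 < x i + y i := fun i => add_pos (hx i) (hy i)
    -- the representation
    have key : ∀ u : ι → ℝ, (∀ i, 0 < u i) → es s (k + 1 + 1) u / es s (k + 1) u =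
        (∑ i ∈ s, u i * es (s.erase i) (k + 1) u / es s (k + 1) u) / ((k : ℝ) + 2) := by
      intro u hu
      rw [← sum_div, ← es_euler s u (k + 1)]
      have : (0 : ℝ) < (k : ℝ) + 2 := by positivity
      push_cast
      have h3 := es_pos hs hu
      field_simp
      ring
    rw [key x hx, key y hy, key _ hxy, ← add_div, ← sum_add_distrib]
    gcongr with i hi
    have hk : k ≤ (s.erase i).card := by rw [card_erase_of_mem hi]; omega
    by_cases hk1 : k + 1 ≤ (s.erase i).card
    · have rep : ∀ u : ι → ℝ, (∀ i, 0 < u i) → u i * es (s.erase i) (k + 1) u / es s (k + 1) u =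
          u i * (es (s.erase i) (k + 1) u / es (s.erase i) k u) /
            (u i + es (s.erase i) (k + 1) u / es (s.erase i) k u) := by
        intro u hu
        rw [es_erase hi]
        have h1 := es_pos hk hu
        have h2 := es_pos hk1 hu
        have h3 := hu i
        field_simp
        ring
      rw [rep x hx, rep y hy, rep _ hxy]
      have px := div_pos (es_pos hk1 hx) (es_pos hk hx)
      have py := div_pos (es_pos hk1 hy) (es_pos hk hy)
      exact (par_superadd (hx i) (hy i) px py).trans
        (par_mono (hxy i) (add_pos px py) (ih _ hk x y hx hy))
    · have z : ∀ w : ι → ℝ, es (s.erase i) (k + 1) w = 0 := fun w => es_eq_zero (by omega) w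
      rw [z, z, z]
      simp

lemma es_midpoint (s : Finset ι) (x y : ι → ℝ) (hx : ∀ i, 0 < x i) (hy : ∀ i, 0 < y i) :
    ∀ k : ℕ, k ≤ s.card →
    4 ^ k * (es s k x * es s k y) ≤ es s k (fun i => x i + y i) ^ 2 := by
  have hxy : ∀ i, 0 < x i + y i := fun i => add_pos (hx i) (hy i)
  intro k
  induction k with
  | zero => intro _; simp [es_zero]
  | succ k ih =>
    intro hk
    have h0 := ih (by omega)
    have h1 := es_ratio k s (by omega) x y hx hy
    have hk' : k ≤ s.card := by omega
    have a1 := es_pos hk' hx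
    have a2 := es_pos hk' hy
    have a3 := es_pos hk' hxy
    have b1 := es_pos hk hx
    have b2 := es_pos hk hy
    have b3 := es_pos hk hxy
    set A := es s (k + 1) x / es s k x with hA
    set B := es s (k + 1) y / es s k y with hB
    set C := es s (k + 1) (fun i => x i + y i) / es s k (fun i => x i + y i) with hC
    have eA : es s (k + 1) x = A * es s k x := by rw [hA]; field_simp
    have eB : es s (k + 1) y = B * es s k y := by rw [hB]; field_simp
    have eC : es s (k + 1) (fun i => x i + y i) = C * es s k (fun i => x i + y i) := by
      rw [hC]; field_simp
    have pA : 0 < A := div_pos b1 a1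
    have pB : 0 < B := div_pos b2 a2
    have h2 : 4 * (A * B) ≤ C ^ 2 := by nlinarith [sq_nonneg (A - B)]
    have h3 := mul_le_mul h2 h0 (by positivity) (by positivity)
    rw [eA, eB, eC]
    calc _ = 4 * (A * B) * (4 ^ k * (es s k x * es s k y)) := by ring
      _ ≤ _ := h3
      _ = _ := by ring

lemma es_mid (s : Finset ι) (u d : ι → ℝ) (k : ℕ) (hk : k ≤ s.card)
    (hx : ∀ i, 0 < u i + d i) (hy : ∀ i, 0 < u i - d i) :
    es s k (fun i => u i + d i) * es s k (fun i => u i - d i) ≤ es s k u ^ 2 := by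
  have h := es_midpoint s _ _ hx hy k hk
  have e : (fun i => (u i + d i) + (u i - d i)) = fun i => 2 * u i := by ext i; ring
  rw [e, es_two, mul_pow, ← pow_mul, mul_comm k 2, pow_mul] at h
  norm_num at h
  exact h

/-- first directional derivative of `es s (k+1)` -/
def dOne (s : Finset ι) (k : ℕ) (d u : ι → ℝ) : ℝ := ∑ i ∈ s, d i * es (s.erase i) k u

/-- second directional derivative of `es s (k+2)` -/
def dTwo (s : Finset ι) (k : ℕ) (d u : ι → ℝ) : ℝ := ∑ i ∈ s, d i * dOne (s.erase i) k d u

lemma hasDerivAt_dOne (s : Finset ι) {u : ℝ → ι → ℝ} {d : ι → ℝ} {x : ℝ}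
    (hu : ∀ i, HasDerivAt (fun t => u t i) (d i) x) (k : ℕ) :
    HasDerivAt (fun t => dOne s (k + 1) d (u t)) (dTwo s k d (u x)) x :=
  HasDerivAt.fun_sum fun i _ => (hasDerivAt_es (s.erase i) hu k).const_mul (d i)

lemma es_second (s : Finset ι) {u : ι → ℝ} (d : ι → ℝ) (hu : ∀ i, 0 < u i) [Finite ι]
    (k : ℕ) (hk : k + 2 ≤ s.card) :
    es s (k + 2) u * dTwo s k d u ≤ dOne s (k + 1) d u ^ 2 := by
  by_contra hcon
  push Not at hcon
  let up : ℝ → ι → ℝ := fun t i => u i + t * d i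
  let um : ℝ → ι → ℝ := fun t i => u i - t * d i
  let d' : ι → ℝ := fun i => - d i
  have hup : ∀ x i, HasDerivAt (fun t => up t i) (d i) x := fun x i => by
    have := ((hasDerivAt_id x).mul_const (d i)).const_add (u i)
    rw [one_mul] at this
    exact this
  have hum : ∀ x i, HasDerivAt (fun t => um t i) (d' i) x := fun x i => by
    simpa using ((hasDerivAt_id x).mul_const (d i)).const_sub (u i)
  have up0 : up 0 = u := by ext i; simp [up]
  have um0 : um 0 = u := by ext i; simp [um]
  have n1 : ∀ (s : Finset ι) (k : ℕ) (w : ι → ℝ), dOne s k d' w = - dOne s k d w := by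
    intro s k w; simp [dOne, d']
  have n2 : ∀ (w : ι → ℝ), dTwo s k d' w = dTwo s k d w := by
    intro w; simp [dTwo, n1, d']
  let h : ℝ → ℝ := fun t => es s (k + 2) (up t) * es s (k + 2) (um t)
  have h1 : ∀ x, HasDerivAt h (dOne s (k + 1) d (up x) * es s (k + 2) (um x) +
      es s (k + 2) (up x) * dOne s (k + 1) d' (um x)) x := fun x =>
    (hasDerivAt_es s (hup x) (k + 1)).mul (hasDerivAt_es s (hum x) (k + 1))
  have hd : deriv h = fun x => dOne s (k + 1) d (up x) * es s (k + 2) (um x) +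
      es s (k + 2) (up x) * dOne s (k + 1) d' (um x) := by
    ext x; exact (h1 x).deriv
  have h2 : HasDerivAt (deriv h)
      (2 * (es s (k + 2) u * dTwo s k d u - dOne s (k + 1) d u ^ 2)) 0 := by
    rw [hd]
    have := ((hasDerivAt_dOne s (hup 0) k).mul (hasDerivAt_es s (hum 0) (k + 1))).add
      ((hasDerivAt_es s (hup 0) (k + 1)).mul (hasDerivAt_dOne s (hum 0) k))
    refine this.congr_deriv ?_
    rw [up0, um0, n2]
    change _ * _ + _ * dOne s (k + 1) d' u + (dOne s (k + 1) d u * _ + _) = _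
    rw [n1]
    ring
  have hmin : IsLocalMin h 0 := by
    apply isLocalMin_of_deriv_deriv_pos
    · rw [h2.deriv]; linarith
    · rw [hd]; simp only [up0, um0, n1]; ring
    · exact (h1 0).continuousAt
  have hev : ∀ᶠ t in nhds (0 : ℝ), (∀ i, 0 < up t i) ∧ (∀ i, 0 < um t i) := by
    apply Filter.Eventually.and
    · rw [Filter.eventually_all]
      intro i
      exact ((hup 0 i).continuousAt).eventually (lt_mem_nhds (by
        change 0 < up 0 i
        rw [up0]; exact hu i))
    · rw [Filter.eventually_all]
      intro i
      exact ((hum 0 i).continuousAt).eventually (lt_mem_nhds (by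
        change 0 < um 0 i
        rw [um0]; exact hu i))
  have hconst : h =ᶠ[nhds 0] fun _ => h 0 := by
    filter_upwards [hev, hmin] with t ht htm
    refine le_antisymm ?_ htm
    have := es_mid s u (fun i => t * d i) (k + 2) hk ht.1 ht.2
    change _ * _ ≤ es s (k + 2) (up 0) * es s (k + 2) (um 0)
    rw [up0, um0, ← sq]
    exact this
  have h3 : deriv (deriv h) 0 = 0 := by
    rw [hconst.deriv.deriv_eq]; simp
  rw [h2.deriv] at h3
  linarith

lemma es_sub (s t : Finset ι) (ht : t ⊆ s) (k : ℕ) (u : ι → ℝ) :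
    es t k u = ∑ W ∈ s.powersetCard k, if W ⊆ t then ∏ i ∈ W, u i else 0 := by
  rw [← sum_filter]
  unfold es
  apply sum_congr _ fun _ _ => rfl
  ext W
  simp only [mem_powersetCard, mem_filter]
  constructor
  · rintro ⟨h1, h2⟩; exact ⟨⟨h1.trans ht, h2⟩, h1⟩
  · rintro ⟨⟨_, h2⟩, h1⟩; exact ⟨h1, h2⟩

/-- the positive quadratic form in the Cauchy-Schwarz step -/
def bForm (s : Finset ι) (k : ℕ) (d u : ι → ℝ) : ℝ :=
  ∑ i ∈ s, ∑ j ∈ s, d i * d j * es ((s.erase i).erase j) k u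

lemma es_cauchy (s : Finset ι) {u : ι → ℝ} (d : ι → ℝ) (hu : ∀ i, 0 < u i) (k : ℕ) :
    dOne s k d u ^ 2 ≤ es s k u * bForm s k d u ∧ 0 ≤ bForm s k d u := by
  let χ : Finset ι → ι → ℝ := fun W i => if i ∈ W then 0 else 1
  let P : Finset ι → ℝ := fun W => ∏ i ∈ W, u i
  have hP : ∀ W, 0 ≤ P W := fun W => prod_nonneg fun i _ => (hu i).le
  have e1 : ∀ i, es (s.erase i) k u = ∑ W ∈ s.powersetCard k, P W * χ W i := by
    intro i
    rw [es_sub s _ (erase_subset i s)]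
    apply sum_congr rfl
    intro W hW
    have hW := (mem_powersetCard.1 hW).1
    simp only [χ, P, subset_erase, hW, true_and]
    split_ifs <;> simp
  have e2 : ∀ i j, es ((s.erase i).erase j) k u =
      ∑ W ∈ s.powersetCard k, P W * (χ W i * χ W j) := by
    intro i j
    rw [es_sub s _ ((erase_subset j _).trans (erase_subset i s))]
    apply sum_congr rfl
    intro W hW
    have hW := (mem_powersetCard.1 hW).1
    simp only [χ, P, subset_erase, hW, true_and]
    split_ifs <;> simp_all
  have h1 : dOne s k d u = ∑ W ∈ s.powersetCard k, P W * ∑ i ∈ s, d i * χ W i := by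
    unfold dOne
    simp only [e1, mul_sum]
    rw [sum_comm]
    exact sum_congr rfl fun _ _ => sum_congr rfl fun _ _ => by ring
  have h2 : bForm s k d u = ∑ W ∈ s.powersetCard k, P W * (∑ i ∈ s, d i * χ W i) ^ 2 := by
    unfold bForm
    simp only [e2, sq, sum_mul_sum]
    simp only [mul_sum]
    calc _ = ∑ i ∈ s, ∑ W ∈ s.powersetCard k, ∑ j ∈ s, d i * d j * (P W * (χ W i * χ W j)) :=
          sum_congr rfl fun _ _ => sum_comm
      _ = _ := by
        rw [sum_comm]
        exact sum_congr rfl fun _ _ => sum_congr rfl fun _ _ => sum_congr rfl fun _ _ => by ring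
  refine ⟨?_, ?_⟩
  · rw [h1, h2]
    apply sum_sq_le_sum_mul_sum_of_sq_le_mul
    · exact fun W _ => hP W
    · exact fun W _ => mul_nonneg (hP W) (sq_nonneg _)
    · intro W _; apply le_of_eq; simp only [P]; ring
  · rw [h2]
    exact sum_nonneg fun W _ => mul_nonneg (hP W) (sq_nonneg _)

/-- tail sums of elementary symmetric polynomials -/
def tl (M : ℕ) (s : Finset ι) (m : ℕ) (u : ι → ℝ) : ℝ := ∑ j ∈ range M, es s (m + j) u

lemma tl_step {M : ℕ} {s : Finset ι} (hM : s.card < M) (m : ℕ) (u : ι → ℝ) :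
    tl M s m u = es s m u + tl M s (m + 1) u := by
  have h : tl M s (m + 1) u + es s m u = tl M s m u + es s (m + M) u := by
    unfold tl
    rw [← sum_range_succ (fun j => es s (m + j) u), sum_range_succ' (fun j => es s (m + j) u)]
    congr 1
    apply sum_congr rfl
    intro j _
    congr 1
    ring
  rw [es_eq_zero (by omega : s.card < m + M)] at h
  linarith

lemma tl_erase {s : Finset ι} {a : ι} (ha : a ∈ s) (M m : ℕ) (u : ι → ℝ) :
    tl M s (m + 1) u = tl M (s.erase a) (m + 1) u + u a * tl M (s.erase a) m u := by
  unfold tl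
  rw [mul_sum, ← sum_add_distrib]
  apply sum_congr rfl
  intro j _
  rw [show m + 1 + j = m + j + 1 by ring]
  exact es_erase ha _ u

lemma tl_nonneg (M : ℕ) (s : Finset ι) (m : ℕ) {u : ι → ℝ} (hu : ∀ i, 0 < u i) :
    0 ≤ tl M s m u := sum_nonneg fun _ _ => es_nonneg _ _ hu

lemma tl_newton (M : ℕ) (s : Finset ι) (k : ℕ) {u : ι → ℝ} (hu : ∀ i, 0 < u i) :
    tl M s (k + 2) u * es s k u ≤ tl M s (k + 1) u * es s (k + 1) u := by
  unfold tl
  rw [sum_mul, sum_mul]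
  apply sum_le_sum
  intro j _
  have := es_newton s hu k (k + 1 + j) (by omega)
  rwa [show k + 1 + j + 1 = k + 2 + j by ring] at this

/-- the main quadratic inequality -/
lemma main_ineq {M : ℕ} {s : Finset ι} [Finite ι] (hM : s.card < M) {u : ι → ℝ} (d : ι → ℝ)
    (hu : ∀ i, 0 < u i) (k : ℕ) (hk : k + 2 ≤ s.card) :
    tl M s (k + 2) u * (dTwo s k d u - bForm s (k + 1) d u) ≤ dOne s (k + 1) d u ^ 2 := by
  obtain ⟨hc, hb⟩ := es_cauchy s d hu (k + 1)
  have h2 := es_second s d hu k hk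
  have h3 := tl_newton M s (k + 1) hu
  have h4 := tl_step hM (k + 2) u
  have e := es_pos hk hu
  have t3 := tl_nonneg M s (k + 3) hu
  have t2 := tl_nonneg M s (k + 2) hu
  change tl M s (k + 3) u * es s (k + 1) u ≤ tl M s (k + 2) u * es s (k + 2) u at h3
  change tl M s (k + 2) u = es s (k + 2) u + tl M s (k + 3) u at h4
  set Q := dTwo s k d u
  set B := bForm s (k + 1) d u
  set L := dOne s (k + 1) d u
  set E := es s (k + 2) u
  set F := es s (k + 1) u
  set T := tl M s (k + 3) u
  set S := tl M s (k + 2) u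
  -- multiply by E
  have a1 : T * (E * Q) ≤ T * L ^ 2 := mul_le_mul_of_nonneg_left h2 t3
  have a2 : T * L ^ 2 ≤ T * (F * B) := mul_le_mul_of_nonneg_left hc t3
  have a3 : T * F * B ≤ S * E * B := mul_le_mul_of_nonneg_right h3 hb
  have a4 : E * (E * Q) ≤ E * L ^ 2 := mul_le_mul_of_nonneg_left h2 e.le
  have a5 : E * (S * (Q - B)) ≤ E * L ^ 2 := by
    have : E * (S * (Q - B)) = E * (E * Q) + T * (E * Q) - S * E * B := by rw [h4]; ring
    rw [this]; linarith
  exact le_of_mul_le_mul_left a5 e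

variable [Fintype ι]

/-- logarithm of the tail probability as a function of the odds `u` -/
noncomputable def logTail (M m : ℕ) (u : ι → ℝ) : ℝ :=
  Real.log (tl M univ m u) - ∑ i, Real.log (1 + u i)

lemma tl_pos {M m : ℕ} {u : ι → ℝ} (hM : (univ : Finset ι).card < M)
    (hm : m ≤ (univ : Finset ι).card) (hu : ∀ i, 0 < u i) : 0 < tl M univ m u := by
  rw [tl_step hM]
  exact add_pos_of_pos_of_nonneg (es_pos hm hu) (tl_nonneg _ _ _ hu)

lemma tl_deriv_identity {M : ℕ} (k : ℕ) {u : ι → ℝ} (d : ι → ℝ) (hu : ∀ i, 0 < u i)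
    (hM : (univ : Finset ι).card < M) :
    ∑ j ∈ range M, dOne univ (k + 1 + j) d u =
      dOne univ (k + 1) (fun i => d i / (1 + u i)) u
        + tl M univ (k + 2) u * ∑ i, d i / (1 + u i) := by
  have h0 : ∑ j ∈ range M, dOne univ (k + 1 + j) d u =
      ∑ i, d i * tl M (univ.erase i) (k + 1) u := by
    unfold dOne tl
    rw [sum_comm]
    simp only [mul_sum]
  rw [h0, mul_sum]
  unfold dOne
  rw [← sum_add_distrib]
  apply sum_congr rfl
  intro i _
  have hc : (univ.erase i : Finset ι).card < M := (card_le_card (erase_subset _ _)).trans_lt hM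
  rw [tl_erase (mem_univ i) M (k + 1) u, tl_step hc (k + 1) u]
  have := hu i
  have h1 : 1 + u i ≠ 0 := by positivity
  field_simp
  ring

lemma hasDerivAt_tl {M : ℕ} (k : ℕ) {u : ℝ → ι → ℝ} {d : ι → ℝ} {x : ℝ}
    (hd : ∀ i, HasDerivAt (fun t => u t i) (d i) x) (hu : ∀ i, 0 < u x i)
    (hM : (univ : Finset ι).card < M) :
    HasDerivAt (fun t => tl M univ (k + 2) (u t))
      (dOne univ (k + 1) (fun i => d i / (1 + u x i)) (u x)
        + tl M univ (k + 2) (u x) * ∑ i, d i / (1 + u x i)) x := by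
  rw [← tl_deriv_identity k d hu hM]
  unfold tl
  apply HasDerivAt.fun_sum
  intro j _
  have := hasDerivAt_es univ hd (k + 1 + j)
  rw [show k + 1 + j + 1 = k + 2 + j by ring] at this
  exact this

lemma hasDerivAt_logTail {M : ℕ} (k : ℕ) {u : ℝ → ι → ℝ} {d : ι → ℝ} {x : ℝ}
    (hd : ∀ i, HasDerivAt (fun t => u t i) (d i) x) (hu : ∀ i, 0 < u x i)
    (hM : (univ : Finset ι).card < M) (hk : k + 2 ≤ (univ : Finset ι).card) :
    HasDerivAt (fun t => logTail M (k + 2) (u t))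
      (dOne univ (k + 1) (fun i => d i / (1 + u x i)) (u x) / tl M univ (k + 2) (u x)) x := by
  have hS := tl_pos hM hk hu
  have h1 := (hasDerivAt_tl k hd hu hM).log hS.ne'
  have h2 : HasDerivAt (fun t => ∑ i, Real.log (1 + u t i)) (∑ i, d i / (1 + u x i)) x := by
    apply HasDerivAt.fun_sum
    intro i _
    have := hu i
    exact ((hd i).const_add 1).log (by positivity)
  refine (h1.sub h2).congr_deriv ?_
  field_simp
  ring

lemma hasDerivAt_ell (k : ℕ) {u : ℝ → ι → ℝ} {d : ι → ℝ} {x : ℝ}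
    (hd : ∀ i, HasDerivAt (fun t => u t i) (d i) x) (hu : ∀ i, 0 < u x i) :
    HasDerivAt (fun t => dOne univ (k + 1) (fun i => d i / (1 + u t i)) (u t))
      (dOne univ (k + 1) (fun i => d i / (1 + u x i)) (u x) * ∑ i, d i / (1 + u x i)
        - ∑ i, (d i / (1 + u x i)) ^ 2 * es (univ.erase i) (k + 1) (u x)
        + dTwo univ k (fun i => d i / (1 + u x i)) (u x)
        - bForm univ (k + 1) (fun i => d i / (1 + u x i)) (u x)) x := by
  have h : HasDerivAt (fun t => dOne univ (k + 1) (fun i => d i / (1 + u t i)) (u t))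
      (∑ i, (-(d i / (1 + u x i)) ^ 2 * es (univ.erase i) (k + 1) (u x)
        + d i / (1 + u x i) * dOne (univ.erase i) k d (u x))) x := by
    apply HasDerivAt.fun_sum
    intro i _
    have hp := hu i
    have h1 : 1 + u x i ≠ 0 := by positivity
    have ha : HasDerivAt (fun t => d i / (1 + u t i)) (-(d i / (1 + u x i)) ^ 2) x := by
      refine ((hasDerivAt_const x (d i)).div ((hd i).const_add 1) h1).congr_deriv ?_
      field_simp
      ring
    exact ha.mul (hasDerivAt_es (univ.erase i) hd k)
  refine h.congr_deriv ?_
  set ξ : ι → ℝ := fun i => d i / (1 + u x i) with hξ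
  have key : ∀ i, dOne (univ.erase i) k d (u x) =
      es (univ.erase i) (k + 1) (u x) * ∑ j, ξ j + dOne (univ.erase i) k ξ (u x)
        - ∑ j, ξ j * es ((univ.erase i).erase j) (k + 1) (u x) := by
    intro i
    rw [← add_sum_erase univ ξ (mem_univ i),
      ← add_sum_erase univ (fun j => ξ j * es ((univ.erase i).erase j) (k + 1) (u x)) (mem_univ i),
      erase_idem]
    have : dOne (univ.erase i) k d (u x) - dOne (univ.erase i) k ξ (u x) =
        es (univ.erase i) (k + 1) (u x) * ∑ j ∈ univ.erase i, ξ j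
        - ∑ j ∈ univ.erase i, ξ j * es ((univ.erase i).erase j) (k + 1) (u x) := by
      unfold dOne
      rw [mul_sum, ← sum_sub_distrib, ← sum_sub_distrib]
      apply sum_congr rfl
      intro j hj
      have hp := hu j
      have h1 : 1 + u x j ≠ 0 := by positivity
      rw [es_erase hj]
      simp only [hξ]
      field_simp
      ring
    linear_combination this
  unfold dTwo bForm
  simp only [dOne] at key ⊢
  rw [sum_mul, ← sum_sub_distrib, ← sum_add_distrib, ← sum_sub_distrib]
  apply sum_congr rfl
  intro i _
  rw [key i]
  have : ∑ j, ξ i * ξ j * es ((univ.erase i).erase j) (k + 1) (u x) =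
      ξ i * ∑ j, ξ j * es ((univ.erase i).erase j) (k + 1) (u x) := by
    rw [mul_sum]; exact sum_congr rfl fun _ _ => by ring
  rw [this]
  change -ξ i ^ 2 * _ + ξ i * _ = _
  ring

lemma line_pos {x y : ι → ℝ} (hx : ∀ i, 0 < x i) (hy : ∀ i, 0 < y i) {t : ℝ}
    (ht : t ∈ Set.Icc (0 : ℝ) 1) (i : ι) : 0 < x i + t * (y i - x i) := by
  have h1 := hx i
  have h2 := hy i
  rcases ht with ⟨h3, h4⟩
  rcases h3.eq_or_lt with h | h
  · rw [← h]; linarith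
  · nlinarith [mul_pos h h2, mul_nonneg (sub_nonneg.2 h4) h1.le]

lemma line_deriv (x d : ι → ℝ) (t : ℝ) (i : ι) :
    HasDerivAt (fun t => x i + t * d i) (d i) t := by
  have := ((hasDerivAt_id t).mul_const (d i)).const_add (x i)
  rw [one_mul] at this
  exact this

lemma logTail_line {M k : ℕ} (hM : (univ : Finset ι).card < M)
    (hk : k + 2 ≤ (univ : Finset ι).card) {x y : ι → ℝ} (hx : ∀ i, 0 < x i) (hy : ∀ i, 0 < y i) :
    ConcaveOn ℝ (Set.Icc (0 : ℝ) 1)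
      (fun t => logTail M (k + 2) (fun i => x i + t * (y i - x i))) := by
  let d : ι → ℝ := fun i => y i - x i
  let u : ℝ → ι → ℝ := fun t i => x i + t * d i
  have hd : ∀ t i, HasDerivAt (fun t => u t i) (d i) t := fun t i => line_deriv x d t i
  have hu : ∀ t ∈ Set.Icc (0 : ℝ) 1, ∀ i, 0 < u t i := fun t ht i => line_pos hx hy ht i
  have D1 := fun t (ht : t ∈ Set.Icc (0 : ℝ) 1) => hasDerivAt_logTail k (hd t) (hu t ht) hM hk
  refine concaveOn_of_hasDerivWithinAt2_nonpos (convex_Icc 0 1)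
    (fun t ht => (D1 t ht).continuousAt.continuousWithinAt)
    (fun t ht => (D1 t (interior_subset ht)).hasDerivWithinAt)
    (fun t ht => ((hasDerivAt_ell k (hd t) (hu t (interior_subset ht))).div
      (hasDerivAt_tl k (hd t) (hu t (interior_subset ht)) hM)
      (tl_pos hM hk (hu t (interior_subset ht))).ne').hasDerivWithinAt) ?_
  intro t ht
  have hp := hu t (interior_subset ht)
  have hm := main_ineq hM (fun i => d i / (1 + u t i)) hp k hk
  have hS := tl_pos hM hk hp
  have hn : 0 ≤ ∑ i, (d i / (1 + u t i)) ^ 2 * es (univ.erase i) (k + 1) (u t) :=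
    sum_nonneg fun i _ => mul_nonneg (sq_nonneg _) (es_nonneg _ _ hp)
  apply div_nonpos_of_nonpos_of_nonneg _ (sq_nonneg _)
  nlinarith [mul_nonneg hS.le hn]

lemma logTail_mono {M k : ℕ} (hM : (univ : Finset ι).card < M)
    (hk : k + 2 ≤ (univ : Finset ι).card) {x y : ι → ℝ} (hx : ∀ i, 0 < x i)
    (hxy : ∀ i, x i ≤ y i) : logTail M (k + 2) x ≤ logTail M (k + 2) y := by
  have hy : ∀ i, 0 < y i := fun i => (hx i).trans_le (hxy i)
  let d : ι → ℝ := fun i => y i - x i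
  let u : ℝ → ι → ℝ := fun t i => x i + t * d i
  have hd : ∀ t i, HasDerivAt (fun t => u t i) (d i) t := fun t i => line_deriv x d t i
  have hu : ∀ t ∈ Set.Icc (0 : ℝ) 1, ∀ i, 0 < u t i := fun t ht i => line_pos hx hy ht i
  have D1 := fun t (ht : t ∈ Set.Icc (0 : ℝ) 1) => hasDerivAt_logTail k (hd t) (hu t ht) hM hk
  have hmono := monotoneOn_of_hasDerivWithinAt_nonneg (convex_Icc (0 : ℝ) 1)
    (fun t ht => (D1 t ht).continuousAt.continuousWithinAt)
    (fun t ht => (D1 t (interior_subset ht)).hasDerivWithinAt)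
    (fun t ht => by
      have hp := hu t (interior_subset ht)
      apply div_nonneg _ (tl_nonneg _ _ _ hp)
      exact sum_nonneg fun i _ => mul_nonneg
        (div_nonneg (sub_nonneg.2 (hxy i)) (by have := hp i; positivity)) (es_nonneg _ _ hp))
  have h := hmono (Set.left_mem_Icc.2 zero_le_one) (Set.right_mem_Icc.2 zero_le_one) zero_le_one
  have e0 : u 0 = x := by ext i; simp [u]
  have e1 : u 1 = y := by ext i; simp [u, d]
  simp only [e0, e1] at h
  exact h

lemma logTail_concave {M k : ℕ} (hM : (univ : Finset ι).card < M)
    (hk : k + 2 ≤ (univ : Finset ι).card) {x y : ι → ℝ} (hx : ∀ i, 0 < x i) (hy : ∀ i, 0 < y i)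
    {a b : ℝ} (ha : 0 ≤ a) (hb : 0 ≤ b) (hab : a + b = 1) :
    a * logTail M (k + 2) x + b * logTail M (k + 2) y ≤
      logTail M (k + 2) (fun i => a * x i + b * y i) := by
  have h := (logTail_line hM hk hx hy).2 (Set.left_mem_Icc.2 zero_le_one)
    (Set.right_mem_Icc.2 zero_le_one) ha hb hab
  have e : (fun i => x i + b * (y i - x i)) = fun i => a * x i + b * y i := by
    ext i; rw [← eq_sub_iff_add_eq] at hab; rw [hab]; ring
  simpa [e] using h

lemma sum_filter_eq_tl {M m : ℕ} (hM : (univ : Finset ι).card < M) (u : ι → ℝ) :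
    ∑ w ∈ (univ : Finset ι).powerset.filter (fun w => m ≤ w.card), ∏ i ∈ w, u i
      = tl M univ m u := by
  unfold tl es
  rw [← sum_fiberwise_of_maps_to (t := range M) (g := fun w => w.card - m)]
  · apply sum_congr rfl
    intro j _
    apply sum_congr _ fun _ _ => rfl
    ext w
    simp only [mem_filter, mem_powerset, mem_powersetCard, subset_univ, true_and]
    omega
  · intro w _
    have := card_le_univ w
    rw [card_univ] at hM
    rw [mem_range]
    omega
end helpers

lemma majority_eq (N : ℕ) (c a r : Fin (2 * N + 1) → ℝ)
    (hc : ∀ t, 0 < c t) (ha : ∀ t, 0 < a t) (v : Fin (2 * N + 1) → ℝ) (hv : ∀ t, 0 < v t) :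
    Real.log (majorityWinProb N c a r v) =
      logTail (2 * N + 2) (N + 1) (fun t => c t * v t ^ r t / a t) := by
  set u : Fin (2 * N + 1) → ℝ := fun t => c t * v t ^ r t / a t with hu
  have hup : ∀ t, 0 < u t := fun t =>
    div_pos (mul_pos (hc t) (Real.rpow_pos_of_pos (hv t) _)) (ha t)
  have hM : (univ : Finset (Fin (2 * N + 1))).card < 2 * N + 2 := by simp
  have hm : N + 1 ≤ (univ : Finset (Fin (2 * N + 1))).card := by simp; omega
  have hp : ∀ t, battleP (c t) (a t) (r t) (v t) = u t / (1 + u t) := by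
    intro t
    have h1 := mul_pos (hc t) (Real.rpow_pos_of_pos (hv t) (r t))
    have h2 := ha t
    simp only [battleP, hu]
    field_simp
    ring
  have hq : ∀ t, 1 - u t / (1 + u t) = 1 / (1 + u t) := by
    intro t
    have := hup t
    field_simp
    ring
  have hD : (0 : ℝ) < ∏ t, (1 + u t) := prod_pos fun t _ => by have := hup t; positivity
  have e : majorityWinProb N c a r v = tl (2 * N + 2) univ (N + 1) u / ∏ t, (1 + u t) := by
    rw [← sum_filter_eq_tl hM, sum_div]
    unfold majorityWinProb
    apply sum_congr rfl
    intro w _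
    simp only [hp, hq]
    clear_value u
    rw [prod_div_distrib, prod_div_distrib, prod_const_one, div_mul_div_comm, mul_one,
      mul_comm (∏ t ∈ w, (1 + u t)), prod_sdiff (subset_univ w)]
  rw [e, Real.log_div (tl_pos hM hm hup).ne' hD.ne', Real.log_prod]
  · rfl
  · intro t _
    have := hup t
    positivity

/-- Log-concavity of the majority-winning probability on the open positive orthant:
`log f` is concave in team A's own prize vector. -/
theorem majorityWinProb_logConcave (N : ℕ) (hN : 1 ≤ N)
    (c a r : Fin (2 * N + 1) → ℝ)
    (hc : ∀ t, 0 < c t) (ha : ∀ t, 0 < a t)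
    (hr : ∀ t, 0 < r t) (hr1 : ∀ t, r t ≤ 1) :
    ConcaveOn ℝ {v : Fin (2 * N + 1) → ℝ | ∀ t, 0 < v t}
      (fun v => Real.log (majorityWinProb N c a r v)) := by
  have hpos : ∀ v : Fin (2 * N + 1) → ℝ, (∀ t, 0 < v t) → ∀ t, 0 < c t * v t ^ r t / a t :=
    fun v hv t => div_pos (mul_pos (hc t) (Real.rpow_pos_of_pos (hv t) _)) (ha t)
  obtain ⟨k, rfl⟩ : ∃ k, N = k + 1 := ⟨N - 1, by omega⟩
  have hM : (univ : Finset (Fin (2 * (k + 1) + 1))).card < 2 * (k + 1) + 2 := by simp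
  have hm : k + 2 ≤ (univ : Finset (Fin (2 * (k + 1) + 1))).card := by
    rw [Finset.card_univ, Fintype.card_fin]; omega
  have hconv : Convex ℝ {v : Fin (2 * (k + 1) + 1) → ℝ | ∀ t, 0 < v t} := by
    intro x hx y hy α β hα hβ hαβ t
    exact (convex_Ioi (0 : ℝ)) (hx t) (hy t) hα hβ hαβ
  refine ⟨hconv, ?_⟩
  intro x hx y hy α β hα hβ hαβ
  have hz := hconv hx hy hα hβ hαβ
  simp only
  rw [majority_eq _ c a r hc ha x hx, majority_eq _ c a r hc ha y hy,
    majority_eq _ c a r hc ha _ hz, smul_eq_mul, smul_eq_mul]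
  refine (logTail_concave hM hm (hpos x hx) (hpos y hy) hα hβ hαβ).trans ?_
  refine logTail_mono hM hm (fun t => ?_) (fun t => ?_)
  · exact (convex_Ioi (0 : ℝ)) (hpos x hx t) (hpos y hy t) hα hβ hαβ
  · have h := (Real.concaveOn_rpow (hr t).le (hr1 t)).2 (hx t).le (hy t).le hα hβ hαβ
    simp only [smul_eq_mul] at h
    have h2 := mul_le_mul_of_nonneg_left h (div_pos (hc t) (ha t)).le
    simp only [Pi.add_apply, Pi.smul_apply, smul_eq_mul]
    calc _ = c t / a t * (α * x t ^ r t + β * y t ^ r t) := by ring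
      _ ≤ _ := h2
      _ = _ := by ring
end
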